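/- arXiv:2402.14120 — 4 statements merged into one kernel-verified Lean document; each statement's English description precedes it below -/
import Mathlib

section
/- Let Op be a finite type and let s, e : Op → ℝ satisfy s(op) ≤ e(op) for every op ∈ Op. Let A ⊆ Op and let p : Op → ℝ satisfy s(a) ≤ p(a) ≤ e(a) for every a ∈ A. Then there exists a strict linear order ≺ on Op such that (i) for all a, a' ∈ A, if p(a) < p(a') then a ≺ a', and (ii) for all op₁, op₂ ∈ Op, if e(op₁) < s(op₂) then op₁ ≺ op₂. -/
/-- Generic ordering lemma (Lemma 1 of the paper): operations with intervals
`[s op, e op]` can be strictly totally ordered so that operations in `A` are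
ordered by their chosen linearization points `p`, and the order of
non-overlapping operations is respected. -/
theorem generic_ordering
    (Op : Type*) [Fintype Op] (s e : Op → ℝ)
    (hse : ∀ op : Op, s op ≤ e op)
    (A : Finset Op) (p : Op → ℝ)
    (hp : ∀ a ∈ A, s a ≤ p a ∧ p a ≤ e a) :
    ∃ lt : Op → Op → Prop, IsStrictTotalOrder Op lt ∧
      (∀ a ∈ A, ∀ a' ∈ A, p a < p a' → lt a a') ∧
      (∀ op₁ op₂ : Op, e op₁ < s op₂ → lt op₁ op₂) := by
  classical
  let q : Op → ℝ := fun x => if x ∈ A then p x else s x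
  have hsq : ∀ x, s x ≤ q x := fun x => by
    by_cases hx : x ∈ A
    · simpa [q, hx] using (hp x hx).1
    · simp [q, hx]
  have hqe : ∀ x, q x ≤ e x := fun x => by
    by_cases hx : x ∈ A
    · simpa [q, hx] using (hp x hx).2
    · simpa [q, hx] using hse x
  let f : Op → ℝ ×ₗ Fin (Fintype.card Op) := fun x => toLex (q x, Fintype.equivFin Op x)
  have hf : Function.Injective f := fun x y h =>
    (Fintype.equivFin Op).injective (congrArg (fun z => (ofLex z).2) h)
  have hlt : ∀ x y, q x < q y → f x < f y := fun x y h =>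
    Prod.Lex.toLex_lt_toLex.2 (Or.inl h)
  let : LinearOrder Op := LinearOrder.lift' f hf
  refine ⟨(· < ·), inferInstance, fun a ha b hb h => hlt a b ?_, fun x y h => hlt x y ?_⟩
  · simpa [q, ha, hb] using h
  · exact (hqe x).trans_lt (h.trans_le (hsq y))
end

section
/- Let P be a type and let (q₁, v₁), …, (q_T, v_T) be a finite sequence of pairs in P × ℕ such that for every index t, v_t equals the number of indices t' < t with q_{t'} = q_t (each process writes the values 0, 1, 2, … in increasing order). For 0 ≤ t ≤ T let M(t) ∈ ℤ be the maximum of the set {v_{t'} : t' ≤ t} ∪ {−1}. Then M(0) = −1, M is nondecreasing, and M(t) ≤ M(t−1) + 1 for every 1 ≤ t ≤ T; in particular, whenever M changes value, the new value equals the previous value plus 1. -/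
/-- If each process writes the values `0, 1, 2, …` in order, every nonzero written value is
preceded by a write of its predecessor. -/
lemma exists_lt_value_succ_eq {P ι : Type*} [DecidableEq P] [Fintype ι] [LinearOrder ι]
    {q : ι → P} {v : ι → ℕ}
    (hv : ∀ t, v t = (Finset.univ.filter (fun t' => t' < t ∧ q t' = q t)).card)
    {t : ι} (ht : v t ≠ 0) : ∃ t' < t, v t' + 1 = v t := by
  set S := Finset.univ.filter (fun t' => t' < t ∧ q t' = q t) with hS
  have hne : S.Nonempty := Finset.card_ne_zero.mp (hv t ▸ ht)
  have hmem : S.max' hne ∈ S := S.max'_mem hne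
  have hmax : ∀ x ∈ S, x ≤ S.max' hne := fun x hx => S.le_max' x hx
  generalize S.max' hne = m at hmem hmax
  obtain ⟨hmt, hqm⟩ : m < t ∧ q m = q t := by simpa [hS] using hmem
  have herase : Finset.univ.filter (fun t' => t' < m ∧ q t' = q m) = S.erase m := by
    ext x
    simp only [Finset.mem_filter, Finset.mem_univ, true_and, Finset.mem_erase]
    constructor
    · rintro ⟨hx, hqx⟩
      exact ⟨hx.ne, by simpa [hS] using ⟨hx.trans hmt, hqx.trans hqm⟩⟩
    · rintro ⟨hxm, hx⟩
      have hqx : x < t ∧ q x = q t := by simpa [hS] using hx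
      exact ⟨lt_of_le_of_ne (hmax x hx) hxm, hqx.2.trans hqm.symm⟩
  exact ⟨m, hmt, by rw [hv m, herase, hv t, Finset.card_erase_add_one hmem]⟩

/-- No-skip lemma for Algorithm 1: writes to the max-register are modeled as a
sequence of pairs (process, value), where each process writes the values
0, 1, 2, … in increasing order, i.e. the value of each write equals the number
of earlier writes by the same process.  `M t` is the value of the max-register
after the first `t` writes (`-1` if there are none).  Then `M` starts at `-1`,
is nondecreasing, increases by at most one at each step, and hence whenever it
changes value, the new value equals the previous value plus one. -/
theorem maxRegister_no_skip
    (P : Type*) [DecidableEq P] (T : ℕ) (q : Fin T → P) (v : Fin T → ℕ)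
    (hv : ∀ t : Fin T,
      v t = (Finset.univ.filter (fun t' : Fin T => t' < t ∧ q t' = q t)).card)
    (M : ℕ → ℤ)
    (hM : ∀ t : ℕ, M t =
      Finset.fold max (-1) (fun t' : Fin T => (v t' : ℤ))
        (Finset.univ.filter (fun t' : Fin T => (t' : ℕ) < t))) :
    M 0 = -1 ∧ Monotone M ∧
      (∀ t : ℕ, 1 ≤ t → t ≤ T → M t ≤ M (t - 1) + 1) ∧
      (∀ t : ℕ, 1 ≤ t → t ≤ T → M t ≠ M (t - 1) → M t = M (t - 1) + 1) := by
  have hle : ∀ (t : ℕ) (c : ℤ), M t ≤ c ↔ -1 ≤ c ∧ ∀ x : Fin T, (x : ℕ) < t → (v x : ℤ) ≤ c := by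
    intro t c
    simp [hM t, Finset.fold_max_le]
  have hmono : Monotone M := fun a b hab =>
    (hle a _).mpr ⟨((hle b _).mp le_rfl).1, fun x hx => ((hle b _).mp le_rfl).2 x (by omega)⟩
  have hstep : ∀ t : ℕ, 1 ≤ t → t ≤ T → M t ≤ M (t - 1) + 1 := by
    intro t _ _
    obtain ⟨hbot, hwrites⟩ := (hle (t - 1) _).mp le_rfl
    refine (hle t _).mpr ⟨by omega, fun x hx => ?_⟩
    by_cases hx0 : v x = 0
    · omega
    · obtain ⟨y, hyx, hy⟩ := exists_lt_value_succ_eq hv hx0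
      have := hwrites y (by omega)
      omega
  refine ⟨by simp [hM 0], hmono, hstep, fun t h1 hT hne => ?_⟩
  have := hmono (Nat.sub_le t 1)
  have := hstep t h1 hT
  omega
end

section
/- Let P be a type, c ∈ ℕ, and let (q₁, v₁), …, (q_T, v_T) be a finite sequence of pairs in P × ℕ. Assume that for every index t with v_t > c, the set of indices t' < t with q_{t'} = q_t is nonempty and, for its largest element t', one has v_{t'} = v_t − 1 (any process writing a value above c wrote exactly one less in its immediately preceding write). Then for every index t with v_t > c there exists an index t'' < t with v_{t''} = v_t − 1; consequently, letting M(t) be the maximum of {v_{t'} : t' ≤ t} ∪ {−1}, if the sequence M(0), …, M(T) attains a value i > c, then it attains the value i − 1 at an earlier point. -/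
/-- No-skip lemma for Algorithm 3: writes to the max-register are modeled as a
sequence of pairs (process, value).  Assume that whenever a process writes a
value above `c`, its immediately preceding write was of exactly one less.
Then every write of a value above `c` is preceded by a write of one less, and
consequently the register value `M` (the running maximum, starting at `-1`)
never attains a value `i > c` without having attained `i - 1` earlier. -/
theorem maxRegister_no_skip_above
    (P : Type*) [DecidableEq P] (c : ℕ) (T : ℕ) (q : Fin T → P) (v : Fin T → ℕ)
    (hprev : ∀ t : Fin T, c < v t →
      ∃ hne : (Finset.univ.filter (fun t' : Fin T => t' < t ∧ q t' = q t)).Nonempty,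
        v ((Finset.univ.filter (fun t' : Fin T => t' < t ∧ q t' = q t)).max' hne)
          = v t - 1)
    (M : ℕ → ℤ)
    (hM : ∀ t : ℕ, M t =
      Finset.fold max (-1) (fun t' : Fin T => (v t' : ℤ))
        (Finset.univ.filter (fun t' : Fin T => (t' : ℕ) < t))) :
    (∀ t : Fin T, c < v t → ∃ t'' : Fin T, t'' < t ∧ v t'' = v t - 1) ∧
      (∀ i : ℤ, (c : ℤ) < i → ∀ t : ℕ, t ≤ T → M t = i →
        ∃ t' : ℕ, t' < t ∧ M t' = i - 1) := by
  have earlier : ∀ t : Fin T, c < v t → ∃ t'' : Fin T, t'' < t ∧ v t'' = v t - 1 := by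
    intro t ht
    obtain ⟨hne, h⟩ := hprev t ht
    exact ⟨_, (Finset.mem_filter.1 (Finset.max'_mem _ hne)).2.1, h⟩
  refine ⟨earlier, fun i hi t _ hMt => ?_⟩
  have reached : ∃ s : Fin T, (s : ℕ) < t ∧ i ≤ v s := by
    have h : i ≤ M t := hMt.ge
    rw [hM, Finset.le_fold_max] at h
    rcases h with h | ⟨s, hs, h⟩
    · omega
    · exact ⟨s, (Finset.mem_filter.1 hs).2, h⟩
  obtain ⟨s, ⟨hst, his⟩, hmin⟩ := WellFounded.has_min (wellFounded_lt (α := Fin T))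
    {s : Fin T | (s : ℕ) < t ∧ i ≤ v s} reached
  have below : ∀ r : Fin T, r < s → (v r : ℤ) ≤ i - 1 := by
    intro r hr
    by_contra h
    exact hmin r ⟨(Fin.lt_def.1 hr).trans hst, by omega⟩ hr
  obtain ⟨r, hr, hvr⟩ := earlier s (by omega)
  refine ⟨s, hst, le_antisymm ?_ ?_⟩
  · rw [hM, Finset.fold_max_le]
    exact ⟨by omega, fun x hx => below x (Finset.mem_filter.1 hx).2⟩
  · rw [hM, Finset.le_fold_max]
    exact Or.inr ⟨r, Finset.mem_filter.2 ⟨Finset.mem_univ r, hr⟩, by omega⟩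
end

section
/- Let n ≥ 1 be a natural number and let k be a real number with k ≥ √(2n). Then for all natural numbers r and v with 2^r ≤ v ≤ n·(2^{r+1} − 1), one has v/k ≤ k·2^r and k·2^r ≤ k·v. -/
/-- Accuracy of Algorithm 1: with `k ≥ √(2n)`, a Read that obtains `r` from
the max-register returns `x = k * 2^r`, and the number `v` of preceding
Increments satisfies `2^r ≤ v ≤ n * (2^(r+1) - 1)`; then `v / k ≤ x ≤ k * v`. -/
theorem algorithm1_accuracy
    (n : ℕ) (hn : 1 ≤ n) (k : ℝ) (hk : Real.sqrt (2 * n) ≤ k) :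
    ∀ r v : ℕ, 2 ^ r ≤ v → v ≤ n * (2 ^ (r + 1) - 1) →
      (v : ℝ) / k ≤ k * 2 ^ r ∧ k * 2 ^ r ≤ k * v := by
  intro r v hrv hvn
  have hn' : (1 : ℝ) ≤ n := by exact_mod_cast hn
  have hk0 : 0 < k := (Real.sqrt_pos.2 (by linarith)).trans_le hk
  have hk2 : 2 * (n : ℝ) ≤ k ^ 2 := (Real.sqrt_le_left hk0.le).1 hk
  have hrv' : (2 : ℝ) ^ r ≤ v := by exact_mod_cast hrv
  have hv : (v : ℝ) ≤ n * 2 ^ (r + 1) := by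
    exact_mod_cast hvn.trans (Nat.mul_le_mul_left n (Nat.sub_le _ _))
  refine ⟨(div_le_iff₀ hk0).2 ?_, mul_le_mul_of_nonneg_left hrv' hk0.le⟩
  calc (v : ℝ) ≤ n * 2 ^ (r + 1) := hv
    _ = 2 * n * 2 ^ r := by ring
    _ ≤ k ^ 2 * 2 ^ r := by gcongr
    _ = k * 2 ^ r * k := by ring
end
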